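/- Let d ≤ −2 be a squarefree integer with d ≡ 2,3 (mod 4), let F = ℚ(√d) ⊆ ℂ, and let (Λ,⟨·,·⟩) be an even unimodular Hermitian lattice over 𝒪_F. Then for every primitive vector r ∈ Λ with ⟨r,r⟩ < 0 and every unit ξ ∈ 𝒪_F^× with ξ ≠ 1, the quasi-reflection τ_{r,ξ} does not map Λ into Λ: there exists ℓ ∈ Λ with τ_{r,ξ}(ℓ) ∉ Λ. -/

import Mathlib

noncomputable section

open Complex

/-- `√d := i·√|d|` for a (negative) integer `d`, as a complex number. -/
def sqrtD (d : ℤ) : ℂ := Complex.I * Real.sqrt (|d| : ℝ)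

/-- The ring of integers of `F = ℚ(√d)`, realized as the subring of `ℂ` consisting of
elements of `ℚ(√d)` that are integral over `ℤ`. -/
def Oring (d : ℤ) : Subring ℂ :=
  (integralClosure ℤ ℂ).toSubring ⊓ (Algebra.adjoin ℚ {sqrtD d}).toSubring

/-- The generator `δ` of the inverse different of `ℚ(√d)`. -/
def deltaF (d : ℤ) : ℂ := if d % 4 = 1 then 1 / sqrtD d else 1 / (2 * sqrtD d)

/-- A vector lies in the standard lattice `𝒪_F^n`. -/
def inLat (d : ℤ) {n : ℕ} (v : Fin n → ℂ) : Prop := ∀ j, v j ∈ Oring d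

/-- A vector lies in the `F`-span `F^n` of the lattice, i.e. in `Λ ⊗ F`. -/
def inSpanF (d : ℤ) {n : ℕ} (v : Fin n → ℂ) : Prop :=
  ∀ j, v j ∈ Algebra.adjoin ℚ {sqrtD d}

/-- `a` is a unit of `𝒪_F`. -/
def IsUnitO (d : ℤ) (a : ℂ) : Prop :=
  a ∈ Oring d ∧ ∃ b ∈ Oring d, a * b = 1

/-- A sesquilinear form on `ℂ^n` (linear in the first variable, conjugate-linear in the
second, Hermitian symmetric); this models a Hermitian form on `Λ ⊗ F` extended by scalars. -/
structure SesqForm (n : ℕ) where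
  toFun : (Fin n → ℂ) → (Fin n → ℂ) → ℂ
  add_left : ∀ x y w, toFun (x + y) w = toFun x w + toFun y w
  smul_left : ∀ (c : ℂ) (x w), toFun (c • x) w = c * toFun x w
  conj_symm : ∀ v w, toFun w v = (starRingEnd ℂ) (toFun v w)

/-- `(𝒪_F^n, Φ)` is a Hermitian lattice: the form takes values in `δ𝒪_F` on lattice vectors. -/
def IsHermLat (d : ℤ) {n : ℕ} (Φ : SesqForm n) : Prop :=
  ∀ v w : Fin n → ℂ, inLat d v → inLat d w → ∃ u ∈ Oring d, Φ.toFun v w = deltaF d * u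

/-- The Hermitian lattice is even: `⟨v,v⟩ ∈ ℤ` for every lattice vector `v`. -/
def IsEvenLat (d : ℤ) {n : ℕ} (Φ : SesqForm n) : Prop :=
  ∀ v, inLat d v → ∃ m : ℤ, Φ.toFun v v = (m : ℂ)

/-- The Hermitian lattice `(𝒪_F^n, Φ)` is unimodular: its dual lattice equals itself. -/
def IsUnimodular (d : ℤ) {n : ℕ} (Φ : SesqForm n) : Prop :=
  ∀ v : Fin n → ℂ,
    (inSpanF d v ∧ ∀ w, inLat d w → ∃ u ∈ Oring d, Φ.toFun v w = deltaF d * u) ↔ inLat d v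

/-- A lattice vector `r` is primitive: `r = a • v` with `a ∈ 𝒪_F`, `v ∈ Λ` forces `a ∈ 𝒪_F^×`. -/
def Primitive (d : ℤ) {n : ℕ} (r : Fin n → ℂ) : Prop :=
  inLat d r ∧ ∀ (a : ℂ) (v : Fin n → ℂ), a ∈ Oring d → inLat d v → r = a • v → IsUnitO d a

/-! ### Helper lemmas -/

lemma conj_sqrtD (d : ℤ) : (starRingEnd ℂ) (sqrtD d) = - sqrtD d := by
  simp [sqrtD]

lemma sqrtD_sq (d : ℤ) (hd : d ≤ -2) : sqrtD d * sqrtD d = (d : ℂ) := by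
  have h1 : (|d| : ℝ) = -(d : ℝ) := by
    apply abs_of_neg
    exact_mod_cast (by omega : d < 0)
  have h0 : (0 : ℝ) ≤ -(d : ℝ) := by
    rw [← h1]; exact abs_nonneg _
  have h2 : Real.sqrt (|d| : ℝ) * Real.sqrt (|d| : ℝ) = -(d : ℝ) := by
    rw [h1]; exact Real.mul_self_sqrt h0
  have h3 : ((Real.sqrt (|d| : ℝ) : ℝ) : ℂ) * ((Real.sqrt (|d| : ℝ) : ℝ) : ℂ) = -(d : ℂ) := by
    exact_mod_cast congrArg (fun x : ℝ => (x : ℂ)) h2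
  unfold sqrtD
  calc _ = (I * I) * (((Real.sqrt (|d| : ℝ) : ℝ) : ℂ) * ((Real.sqrt (|d| : ℝ) : ℝ) : ℂ)) := by ring
    _ = _ := by rw [h3, I_mul_I]; ring

lemma adj_repr (d : ℤ) (hd : d ≤ -2) (x : ℂ) (hx : x ∈ Algebra.adjoin ℚ {sqrtD d}) :
    ∃ p q : ℚ, x = p + q * sqrtD d := by
  have hs := sqrtD_sq d hd
  induction hx using Algebra.adjoin_induction with
  | mem x hx => exact ⟨0, 1, by simp_all⟩
  | algebraMap r => exact ⟨r, 0, by simp⟩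
  | add x y _ _ hx hy =>
    obtain ⟨p, q, rfl⟩ := hx
    obtain ⟨p', q', rfl⟩ := hy
    exact ⟨p + p', q + q', by push_cast; ring⟩
  | mul x y _ _ hx hy =>
    obtain ⟨p, q, rfl⟩ := hx
    obtain ⟨p', q', rfl⟩ := hy
    refine ⟨p * p' + q * q' * d, p * q' + q * p', ?_⟩
    push_cast
    linear_combination (q * q' : ℂ) * hs

lemma conj_repr (d : ℤ) (p q : ℚ) :
    (starRingEnd ℂ) ((p : ℂ) + q * sqrtD d) = p - q * sqrtD d := by
  have hp : (starRingEnd ℂ) (p : ℂ) = p := map_ratCast _ _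
  have hq : (starRingEnd ℂ) (q : ℂ) = q := map_ratCast _ _
  rw [map_add, map_mul, conj_sqrtD, hp, hq]; ring

lemma rat_mem_adj (d : ℤ) (p : ℚ) : (p : ℂ) ∈ Algebra.adjoin ℚ {sqrtD d} := by
  simpa using (Algebra.adjoin ℚ {sqrtD d}).algebraMap_mem p

lemma int_mem_O (d m : ℤ) : (m : ℂ) ∈ Oring d := intCast_mem _ m

lemma mem_O {d : ℤ} {x : ℂ} :
    x ∈ Oring d ↔ IsIntegral ℤ x ∧ x ∈ Algebra.adjoin ℚ {sqrtD d} := Iff.rfl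

lemma conj_mem_adj (d : ℤ) (hd : d ≤ -2) (x : ℂ) (hx : x ∈ Algebra.adjoin ℚ {sqrtD d}) :
    (starRingEnd ℂ) x ∈ Algebra.adjoin ℚ {sqrtD d} := by
  obtain ⟨p, q, rfl⟩ := adj_repr d hd x hx
  rw [conj_repr]
  exact sub_mem (rat_mem_adj d p)
    (mul_mem (rat_mem_adj d q) (Algebra.subset_adjoin rfl))

lemma conj_mem_O (d : ℤ) (hd : d ≤ -2) (x : ℂ) (hx : x ∈ Oring d) :
    (starRingEnd ℂ) x ∈ Oring d := by
  rw [mem_O] at hx ⊢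
  refine ⟨?_, conj_mem_adj d hd x hx.2⟩
  exact hx.1.map ((starRingEnd ℂ).toIntAlgHom)

lemma rat_int (p : ℚ) (h : IsIntegral ℤ (p : ℂ)) : ∃ m : ℤ, (p : ℂ) = m := by
  have h1 : IsIntegral ℤ p := by
    have : IsIntegral ℤ (algebraMap ℚ ℂ p) := by simpa using h
    exact (isIntegral_algebraMap_iff (algebraMap ℚ ℂ).injective).1 this
  obtain ⟨m, hm⟩ := IsIntegrallyClosed.isIntegral_iff.1 h1
  exact ⟨m, by rw [← hm]; simp⟩

lemma norm_int (d : ℤ) (hd : d ≤ -2) (x : ℂ) (hx : x ∈ Oring d) :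
    ∃ m : ℤ, (starRingEnd ℂ) x * x = m := by
  have h := (mul_mem (conj_mem_O d hd x hx) hx)
  obtain ⟨p, q, rfl⟩ := adj_repr d hd x hx.2
  have e : (starRingEnd ℂ) ((p : ℂ) + q * sqrtD d) * (p + q * sqrtD d)
      = ((p * p - q * q * d : ℚ) : ℂ) := by
    rw [conj_repr]; push_cast
    linear_combination (-(q * q) : ℂ) * sqrtD_sq d hd
  rw [e] at h ⊢
  exact rat_int _ h.1

lemma int_of_tr_norm (x : ℂ) (t m : ℤ) (ht : (starRingEnd ℂ) x + x = t)
    (hm : (starRingEnd ℂ) x * x = m) : IsIntegral ℤ x := by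
  refine ⟨Polynomial.X ^ 2 - Polynomial.C t * Polynomial.X + Polynomial.C m, by monicity!, ?_⟩
  simp only [Polynomial.eval₂_add, Polynomial.eval₂_sub, Polynomial.eval₂_mul,
    Polynomial.eval₂_pow, Polynomial.eval₂_X, Polynomial.eval₂_C]
  simp only [eq_intCast, ← ht, ← hm]
  ring

lemma conj_mul_normSq (x : ℂ) : (starRingEnd ℂ) x * x = (normSq x : ℂ) := by
  rw [mul_comm, mul_conj]

lemma Phi_smul_right {n : ℕ} (Φ : SesqForm n) (c : ℂ) (v w : Fin n → ℂ) :
    Φ.toFun v (c • w) = (starRingEnd ℂ) c * Φ.toFun v w := by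
  rw [Φ.conj_symm (c • w) v, Φ.smul_left, map_mul, ← Φ.conj_symm]

lemma Phi_add_right {n : ℕ} (Φ : SesqForm n) (v x y : Fin n → ℂ) :
    Φ.toFun v (x + y) = Φ.toFun v x + Φ.toFun v y := by
  rw [Φ.conj_symm (x + y) v, Φ.add_left, map_add, ← Φ.conj_symm, ← Φ.conj_symm]

lemma unit_normSq (d : ℤ) (hd : d ≤ -2) (ξ η : ℂ) (h : ξ ∈ Oring d) (h' : η ∈ Oring d)
    (e : ξ * η = 1) : normSq ξ = 1 := by
  obtain ⟨a, ha⟩ := norm_int d hd ξ h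
  obtain ⟨b, hb⟩ := norm_int d hd η h'
  rw [conj_mul_normSq] at ha hb
  have ha' : normSq ξ = (a : ℝ) := by exact_mod_cast ha
  have hb' : normSq η = (b : ℝ) := by exact_mod_cast hb
  have hab : a * b = 1 := by
    have := congrArg normSq e
    rw [normSq_mul, ha', hb', normSq_one] at this
    exact_mod_cast this
  have ha0 : 0 ≤ a := by
    have := normSq_nonneg ξ
    rw [ha'] at this; exact_mod_cast this
  rw [ha', Int.eq_one_of_mul_eq_one_right ha0 hab]; simp

lemma normSq_sqrtD (d : ℤ) (hd : d ≤ -2) : normSq (sqrtD d) = -(d : ℝ) := by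
  have h1 := conj_mul_normSq (sqrtD d)
  rw [conj_sqrtD, neg_mul, sqrtD_sq d hd] at h1
  exact_mod_cast h1.symm

/-- The final contradiction: `(1-ξ)δ` cannot be integral. -/
lemma final_contra (d : ℤ) (hd : d ≤ -2) (ξ : ℂ) (h1 : normSq ξ = 1) (hne : ξ ≠ 1)
    (h : (1 - ξ) * (1 / (2 * sqrtD d)) ∈ Oring d) : False := by
  obtain ⟨a, ha⟩ := norm_int d hd _ h
  rw [conj_mul_normSq] at ha
  have ha' : normSq ((1 - ξ) * (1 / (2 * sqrtD d))) = (a : ℝ) := by exact_mod_cast ha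
  rw [normSq_mul, normSq_div, normSq_mul, normSq_sqrtD d hd, normSq_one] at ha'
  have h2 : normSq (2 : ℂ) = 4 := by rw [normSq_ofNat]; norm_num
  rw [h2] at ha'
  have hdr : (d : ℝ) ≤ -2 := by exact_mod_cast hd
  have hpos : 0 < normSq (1 - ξ) := normSq_pos.2 (sub_ne_zero.2 (Ne.symm hne))
  have hle : normSq (1 - ξ) ≤ 4 := by
    rw [normSq_apply] at h1 ⊢
    simp only [sub_re, sub_im, one_re, one_im]
    nlinarith [sq_nonneg (ξ.im), sq_nonneg (ξ.re + 1)]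
  have hk : normSq (1 - ξ) = a * (4 * -(d : ℝ)) := by
    rw [← ha']; field_simp [show (d : ℝ) ≠ 0 by linarith]
  rcases le_or_gt a 0 with h0 | h0
  · have : (a : ℝ) ≤ 0 := by exact_mod_cast h0
    nlinarith
  · have : (1 : ℝ) ≤ a := by exact_mod_cast h0
    nlinarith

/-- Let `d ≤ -2` be squarefree with `d ≡ 2,3 (mod 4)` and let `(Λ,⟨·,·⟩)` be an
even unimodular Hermitian lattice over `𝒪_F`. For every primitive `r ∈ Λ` with `⟨r,r⟩ < 0` and
every unit `ξ ∈ 𝒪_F^×` with `ξ ≠ 1`, the quasi-reflection `τ_{r,ξ}` does not map `Λ` into `Λ`: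
there is `ℓ ∈ Λ` with `τ_{r,ξ}(ℓ) = ℓ - (1-ξ)(⟨ℓ,r⟩/⟨r,r⟩)·r ∉ Λ`. -/
theorem quasiReflection_not_mapsTo
    (d : ℤ) (hd : d ≤ -2) (hsf : Squarefree d)
    (hmod : d % 4 = 2 ∨ d % 4 = 3)
    (n : ℕ) (Φ : SesqForm n) (hΦ : IsHermLat d Φ)
    (heven : IsEvenLat d Φ) (huni : IsUnimodular d Φ)
    (r : Fin n → ℂ) (hr : Primitive d r)
    (hneg : ∃ t : ℝ, t < 0 ∧ Φ.toFun r r = (t : ℂ))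
    (ξ : ℂ) (hξO : ξ ∈ Oring d) (hξunit : ∃ η ∈ Oring d, ξ * η = 1) (hξne : ξ ≠ 1) :
    ∃ ℓ : Fin n → ℂ, inLat d ℓ ∧
      ¬ inLat d (ℓ - ((1 - ξ) * (Φ.toFun ℓ r / Φ.toFun r r)) • r) := by
  by_contra hcon
  push Not at hcon
  obtain ⟨hrL, -⟩ := hr
  obtain ⟨t, ht0, htr⟩ := hneg
  obtain ⟨N, hN⟩ := heven r hrL
  have hN0 : (N : ℂ) ≠ 0 := by
    rw [← hN, htr]; exact_mod_cast ht0.ne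
  have hNz : N ≠ 0 := by exact_mod_cast hN0
  have hs0 : sqrtD d ≠ 0 := by
    intro h
    have := sqrtD_sq d hd
    rw [h] at this
    have : (d : ℂ) = 0 := by simpa using this.symm
    have : d = 0 := by exact_mod_cast this
    omega
  have hδ : deltaF d = 1 / (2 * sqrtD d) := by
    unfold deltaF; rw [if_neg (by omega)]
  have hδ0 : deltaF d ≠ 0 := by rw [hδ]; simp [hs0]
  have hδc : (starRingEnd ℂ) (deltaF d) = - deltaF d := by
    have h2 : (starRingEnd ℂ) (2 : ℂ) = 2 := map_ofNat _ 2
    rw [hδ, map_div₀, map_mul, conj_sqrtD, h2, map_one]; field_simp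
  -- a ℓ
  set a : (Fin n → ℂ) → ℂ := fun ℓ => Φ.toFun r ℓ / deltaF d with ha
  have haΦ : ∀ ℓ, Φ.toFun r ℓ = deltaF d * a ℓ := by
    intro ℓ; simp only [ha]; field_simp
  have haO : ∀ ℓ, inLat d ℓ → a ℓ ∈ Oring d := by
    intro ℓ hℓ
    obtain ⟨u, hu, e⟩ := hΦ r ℓ hrL hℓ
    have : a ℓ = u := by simp only [ha]; rw [e]; field_simp
    rwa [this]
  have haadd : ∀ x y, a (x + y) = a x + a y := by
    intro x y; simp only [ha]; rw [Phi_add_right]; ring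
  clear_value a
  have hΦc : ∀ ℓ, Φ.toFun ℓ r = - deltaF d * (starRingEnd ℂ) (a ℓ) := by
    intro ℓ; rw [Φ.conj_symm r ℓ, haΦ, map_mul, hδc]
  have hLadd : ∀ x y : Fin n → ℂ, inLat d x → inLat d y → inLat d (x + y) :=
    fun x y hx hy j => add_mem (hx j) (hy j)
  let S : Set ℤ := {k | ∃ ℓ, inLat d ℓ ∧ (starRingEnd ℂ) (a ℓ) * a ℓ = (k : ℂ)}
  obtain ⟨m, hm⟩ := Int.subgroup_cyclic (AddSubgroup.closure S)
  have hmdvd : ∀ k ∈ S, ∃ c : ℤ, k = c * m := by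
    intro k hk
    have h1 : k ∈ AddSubgroup.closure S := AddSubgroup.subset_closure hk
    rw [hm, AddSubgroup.mem_closure_singleton] at h1
    obtain ⟨c, hc⟩ := h1
    exact ⟨c, by rw [← hc]; simp⟩
  have hmS : m ∈ AddSubgroup.closure S := by
    rw [hm]; exact AddSubgroup.subset_closure rfl
  have hnorm : ∀ ℓ, inLat d ℓ → ∃ c : ℤ, (starRingEnd ℂ) (a ℓ) * a ℓ = c * m := by
    intro ℓ hℓ
    obtain ⟨k, hk⟩ := norm_int d hd _ (haO ℓ hℓ)
    obtain ⟨c, hc⟩ := hmdvd k ⟨ℓ, hℓ, hk⟩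
    exact ⟨c, by rw [hk, hc]; push_cast; ring⟩
  have hm0 : (m : ℂ) ≠ 0 := by
    intro h0
    obtain ⟨c, hc⟩ := hnorm r hrL
    rw [h0, mul_zero, conj_mul_normSq] at hc
    have h2 : a r = 0 := by
      apply normSq_eq_zero.1; exact_mod_cast hc
    have h3 := haΦ r
    rw [h2, mul_zero, hN] at h3
    exact hN0 h3
  have hmz : m ≠ 0 := by exact_mod_cast hm0
  have hmc : (starRingEnd ℂ) (m : ℂ) = m := map_intCast _ _
  -- conj a * b / m is integral
  have hab : ∀ x y, inLat d x → inLat d y →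
      (starRingEnd ℂ) (a x) * a y / m ∈ Oring d := by
    intro x y hx hy
    obtain ⟨c1, h1⟩ := hnorm x hx
    obtain ⟨c2, h2⟩ := hnorm y hy
    obtain ⟨c3, h3⟩ := hnorm _ (hLadd x y hx hy)
    rw [haadd, map_add] at h3
    rw [mem_O]
    constructor
    · apply int_of_tr_norm _ (c3 - c1 - c2) (c1 * c2)
      · rw [map_div₀, map_mul, hmc, conj_conj]
        field_simp
        push_cast
        linear_combination h3 - h1 - h2
      · rw [map_div₀, map_mul, hmc, conj_conj]
        field_simp
        push_cast
        linear_combination ((starRingEnd ℂ) (a y) * a y) * h1 + (c1 * m : ℂ) * h2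
    · have := rat_mem_adj d ((m : ℚ)⁻¹)
      rw [div_eq_mul_inv]
      refine mul_mem (mul_mem (conj_mem_O d hd _ (haO x hx)).2 (haO y hy).2) ?_
      simpa using this
  have hvec : ∀ x, inLat d x → inLat d (((starRingEnd ℂ) (a x) / m) • r) := by
    intro x hx
    rw [← huni]
    constructor
    · intro j
      have := rat_mem_adj d ((m : ℚ)⁻¹)
      rw [Pi.smul_apply, smul_eq_mul, div_eq_mul_inv]
      refine mul_mem (mul_mem (conj_mem_O d hd _ (haO x hx)).2 ?_) (hrL j).2
      simpa using this
    · intro w hw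
      refine ⟨_, hab x w hx hw, ?_⟩
      rw [Φ.smul_left, haΦ]; ring
  have hdiv : m ^ 2 ∣ m * N := by
    refine AddSubgroup.closure_induction (p := fun k _ => m ^ 2 ∣ k * N) ?_ ?_ ?_ ?_ hmS
    · rintro k ⟨x, hx, hk⟩
      obtain ⟨q, hq⟩ := heven _ (hvec x hx)
      rw [Φ.smul_left, Phi_smul_right, hN, map_div₀, conj_conj, hmc] at hq
      refine ⟨q, ?_⟩
      have : (k : ℂ) * N = m ^ 2 * q := by
        rw [← hq, ← hk]; field_simp
      exact_mod_cast this
    · simp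
    · intro x y _ _ hx hy; rw [add_mul]; exact dvd_add hx hy
    · intro x _ hx; rw [neg_mul]; exact (dvd_neg).2 hx
  obtain ⟨k, hk⟩ := hdiv
  have hNk : (N : ℂ) = m * k := by
    have : N = m * k := by
      apply mul_left_cancel₀ hmz; rw [hk]; ring
    exact_mod_cast this
  have hk0 : (k : ℂ) ≠ 0 := by
    intro h; rw [h, mul_zero] at hNk; exact hN0 hNk
  have hfin : (m : ℂ) * ((1 - ξ) * deltaF d / N) ∈ Oring d := by
    refine AddSubgroup.closure_induction
      (p := fun (k : ℤ) _ => (k : ℂ) * ((1 - ξ) * deltaF d / N) ∈ Oring d) ?_ ?_ ?_ ?_ hmS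
    · rintro k ⟨x, hx, hk⟩
      have h1 : inLat d (((1 - ξ) * (Φ.toFun x r / Φ.toFun r r)) • r) := by
        intro j
        have h2 := sub_mem (hx j) (hcon x hx j)
        simpa using h2
      obtain ⟨u, hu, e⟩ := hΦ _ x h1 hx
      rw [Φ.smul_left, hN, hΦc x, haΦ x] at e
      have : (k : ℂ) * ((1 - ξ) * deltaF d / N) = -u := by
        rw [← hk]
        apply mul_left_cancel₀ hδ0
        rw [mul_neg, ← e]; ring
      rw [this]; exact neg_mem hu
    · simp
    · intro x y _ _ hx hy; push_cast; rw [add_mul]; exact add_mem hx hy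
    · intro x _ hx; push_cast; rw [neg_mul]; exact neg_mem hx
  have hfin2 : (1 - ξ) * (1 / (2 * sqrtD d)) ∈ Oring d := by
    have := mul_mem (int_mem_O d k) hfin
    have e : (k : ℂ) * ((m : ℂ) * ((1 - ξ) * deltaF d / N)) = (1 - ξ) * deltaF d := by
      rw [hNk]; field_simp
    rw [e, hδ] at this
    exact this
  obtain ⟨η, hη, hξη⟩ := hξunit
  exact final_contra d hd ξ (unit_normSq d hd ξ η hξO hη hξη) hξne hfin2
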